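/- arXiv:math/0401349 — 2 statements merged into one kernel-verified Lean document; each statement's English description precedes it below -/
import Mathlib

section
/- Let Δ ∈ F be not cyclically reduced (i.e. there exists g ∈ F with ‖g⁻¹ * Δ * g‖ < ‖Δ‖), and let V ∈ F satisfy ‖V‖ ≤ ‖Δ⁻¹ * V * Δ‖ and ‖V‖ ≤ ‖Δ * V * Δ⁻¹‖. Then either V is Δ-reduced, or the following holds: there exist U₁, U₂, Δ₁₁, Δ₂, W ∈ F and an integer k with |k| > 1 such that Δ = U₁⁻¹ * U₂⁻¹ * Δ₁₁⁻¹ * Δ₂ * Δ₁₁ * U₂ * U₁ norm-additively (‖Δ‖ = 2‖U₁‖ + 2‖U₂‖ + 2‖Δ₁₁‖ + ‖Δ₂‖), V = U₁⁻¹ * U₂⁻¹ * W * U₂ * U₁ norm-additively (‖V‖ = 2‖U₁‖ + 2‖U₂‖ + ‖W‖) with W cyclically reduced, ‖Δ^(−k) * V * Δ^k‖ < ‖V‖, and the element Δ^(−k) * V * Δ^k is Δ-reduced. -/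
open FreeGroup

namespace FreeGroup

variable {α : Type*}

/-- The conjugate of `V` by the element represented by the word `L`. -/
def conjWord (V : FreeGroup α) (L : List (α × Bool)) : FreeGroup α :=
  (mk L)⁻¹ * V * mk L

theorem conjWord_nil (V : FreeGroup α) : conjWord V [] = V := by
  simp [conjWord, ← one_eq_mk]

theorem conjWord_append (V : FreeGroup α) (L M : List (α × Bool)) :
    conjWord V (L ++ M) = conjWord (conjWord V L) M := by
  simp only [conjWord, ← mul_mk]
  group

theorem conjWord_cons (V : FreeGroup α) (a : α × Bool) (L : List (α × Bool)) :
    conjWord V (a :: L) = conjWord (conjWord V [a]) L :=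
  conjWord_append V [a] L

theorem mk_singleton_inv (a : α × Bool) :
    (mk [a])⁻¹ = mk [(a.1, !a.2)] := by
  simp [inv_mk, invRev]

theorem conjWord_singleton_inv (V : FreeGroup α) (a : α × Bool) :
    conjWord (conjWord V [a]) [(a.1, !a.2)] = V := by
  simp only [conjWord, ← mk_singleton_inv]
  group

variable [DecidableEq α]

theorem IsReduced.norm_mk {L : List (α × Bool)} (h : IsReduced L) :
    (mk L).norm = L.length := by
  rw [norm, toWord_mk, h.reduce_eq]

theorem norm_conjWord_le (V : FreeGroup α) (L : List (α × Bool)) :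
    (conjWord V L).norm ≤ V.norm + 2 * L.length := by
  have h₁ := norm_mul_le ((mk L)⁻¹ * V) (mk L)
  have h₂ := norm_mul_le (mk L)⁻¹ V
  have h₃ : (mk L).norm ≤ L.length := norm_mk_le
  rw [norm_inv_eq] at h₂
  unfold conjWord
  omega

/-- If conjugation by a letter shortens `U`, then `U` starts with that letter and ends with its
inverse. -/
theorem exists_toWord_eq_of_norm_conjWord_lt {U : FreeGroup α} {a : α × Bool}
    (h : (conjWord U [a]).norm < U.norm) :
    ∃ W, U.toWord = a :: (W ++ [(a.1, !a.2)]) := by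
  have hU : U = mk U.toWord := mk_toWord.symm
  have hred : IsReduced U.toWord := isReduced_toWord
  have hn : U.norm = U.toWord.length := rfl
  have ha : (mk [a]).norm = 1 := IsReduced.singleton.norm_mk
  generalize U.toWord = L at hU hred hn
  induction L using List.bidirectionalRec with
  | nil => simp_all
  | singleton c =>
    exfalso
    have h0 : conjWord U [a] = 1 := by
      rw [← norm_eq_zero]
      simp at hn
      omega
    have h1 : U = 1 := by
      rw [← conjWord_singleton_inv U a, h0]
      rw [conjWord, mul_one, inv_mul_cancel]
    simp [h1] at hn
  | cons_append c W d _ =>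
    by_cases hc : c = a
    · by_cases hd : d = (a.1, !a.2)
      · exact ⟨W, by rw [hc, hd]⟩
      · exfalso
        have hr : IsReduced (c :: W ++ [d, a]) := by
          have : IsReduced ((c :: W) ++ [d] ++ [a]) := by
            refine IsReduced.append_overlap (by simpa using hred) ?_ (by simp)
            simp only [List.singleton_append, isReduced_cons_cons, IsReduced.singleton, and_true]
            intro h1
            by_contra h2
            exact hd (Prod.ext h1 (by simpa using Bool.eq_not.2 h2))
          simpa using this
        have h1 : (U * mk [a]).norm = U.norm + 1 := by
          have : U * mk [a] = mk (c :: W ++ [d, a]) := by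
            rw [hU, mul_mk]
            simp
          rw [this, hr.norm_mk, hn]
          simp
        have h2 := norm_mul_le (mk [a]) (conjWord U [a])
        have h3 : mk [a] * conjWord U [a] = U * mk [a] := by
          simp only [conjWord]
          group
        rw [h3, h1, ha] at h2
        omega
    · exfalso
      have hr : IsReduced ((a.1, !a.2) :: c :: (W ++ [d])) := by
        rw [isReduced_cons_cons]
        refine ⟨fun h1 => ?_, hred⟩
        by_contra h2
        refine hc (Prod.ext h1.symm ?_)
        simp only at h2
        cases hc2 : c.2 <;> cases ha2 : a.2 <;> simp_all
      have h1 : ((mk [a])⁻¹ * U).norm = U.norm + 1 := by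
        have : (mk [a])⁻¹ * U = mk ((a.1, !a.2) :: c :: (W ++ [d])) := by
          rw [mk_singleton_inv, hU, mul_mk]
          simp
        rw [this, hr.norm_mk, hn]
        simp
      have h2 := norm_mul_le (conjWord U [a]) (mk [a])⁻¹
      have h3 : conjWord U [a] * (mk [a])⁻¹ = (mk [a])⁻¹ * U := by
        simp only [conjWord]
        group
      rw [h3, h1, norm_inv_eq, ha] at h2
      omega

/-- At most one letter shortens `U` by conjugation; all the others lengthen it. -/
theorem norm_conjWord_singleton_of_lt {U : FreeGroup α} {a b : α × Bool}
    (h : (conjWord U [a]).norm < U.norm) (hab : a ≠ b) :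
    (conjWord U [b]).norm = U.norm + 2 := by
  obtain ⟨W, hW⟩ := exists_toWord_eq_of_norm_conjWord_lt h
  have hred : IsReduced U.toWord := isReduced_toWord
  rw [hW] at hred
  have hr : IsReduced (((b.1, !b.2) :: a :: W) ++ [(a.1, !a.2)] ++ [b]) := by
    refine IsReduced.append_overlap ?_ ?_ (by simp)
    · simp only [List.cons_append, isReduced_cons_cons]
      refine ⟨fun h1 => ?_, hred⟩
      by_contra h2
      refine hab (Prod.ext h1.symm ?_)
      cases hb2 : b.2 <;> cases ha2 : a.2 <;> simp_all
    · simp only [List.singleton_append, isReduced_cons_cons, IsReduced.singleton, and_true]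
      intro h1
      by_contra h2
      refine hab (Prod.ext h1 ?_)
      cases hb2 : b.2 <;> cases ha2 : a.2 <;> simp_all
  have hU : U = mk (a :: (W ++ [(a.1, !a.2)])) := by rw [← hW, mk_toWord]
  have hc : conjWord U [b] = mk (((b.1, !b.2) :: a :: W) ++ [(a.1, !a.2)] ++ [b]) := by
    rw [conjWord, mk_singleton_inv, hU, mul_mk, mul_mk]
    simp
  rw [hc, hr.norm_mk, norm, hW]
  simp

theorem norm_conjWord_singleton_of_gt {V : FreeGroup α} {a b : α × Bool}
    (h : V.norm < (conjWord V [a]).norm) (hab : IsReduced [a, b]) :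
    (conjWord V [a, b]).norm = (conjWord V [a]).norm + 2 := by
  rw [conjWord_cons]
  refine norm_conjWord_singleton_of_lt (a := (a.1, !a.2)) ?_ ?_
  · rwa [conjWord_singleton_inv]
  · rintro rfl
    simp [isReduced_cons_cons] at hab

theorem norm_conjWord_singleton_eq_add_two {V : FreeGroup α} {a : α × Bool}
    (h : V.norm < (conjWord V [a]).norm) : (conjWord V [a]).norm = V.norm + 2 := by
  obtain ⟨W, hW⟩ := exists_toWord_eq_of_norm_conjWord_lt
    (U := conjWord V [a]) (a := (a.1, !a.2)) (by rwa [conjWord_singleton_inv])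
  have hV : V = mk W := by
    have h1 : (mk [a])⁻¹ * V * mk [a] = (mk [a])⁻¹ * mk W * mk [a] := by
      rw [← conjWord, ← mk_toWord (x := conjWord V [a]), hW, mk_singleton_inv, mul_mk, mul_mk]
      simp
    exact mul_left_cancel (mul_right_cancel h1)
  have hle : V.norm ≤ W.length := hV ▸ norm_mk_le
  have hlen : (conjWord V [a]).norm = W.length + 2 := by
    rw [norm, hW]
    simp
  have h3 := norm_conjWord_le V [a]
  simp only [List.length_singleton] at h3
  omega

/-- Once conjugation along a reduced word starts to lengthen `V`, it does so with every letter. -/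
theorem norm_conjWord_cons_of_gt {a : α × Bool} {L : List (α × Bool)} {V : FreeGroup α}
    (h : V.norm < (conjWord V [a]).norm) (hL : IsReduced (a :: L)) :
    (conjWord V (a :: L)).norm = (conjWord V [a]).norm + 2 * L.length := by
  induction L generalizing a V with
  | nil => simp
  | cons b L ih =>
    have hab : IsReduced [a, b] := hL.infix ⟨[], L, by simp⟩
    have h1 := norm_conjWord_singleton_of_gt h hab
    rw [conjWord_cons V a [b]] at h1
    rw [conjWord_cons, ih (by omega) (isReduced_cons_cons.1 hL).2, h1, List.length_cons]
    ring

/-- A conjugation along a reduced word that does not begin with the shortening letter lengthens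
with every letter. -/
theorem norm_conjWord_of_lt {z : α × Bool} {L : List (α × Bool)} {V : FreeGroup α}
    (hz : (conjWord V [z]).norm < V.norm) (hL : IsReduced L) (hne : L.head? ≠ some z) :
    (conjWord V L).norm = V.norm + 2 * L.length := by
  cases L with
  | nil => simp [conjWord_nil]
  | cons a L =>
    have h1 := norm_conjWord_singleton_of_lt (b := a) hz (by rintro rfl; simp at hne)
    rw [norm_conjWord_cons_of_gt (by omega) hL, h1, List.length_cons]
    ring

theorem norm_conjWord_le_of_concat_le {L : List (α × Bool)} {x : α × Bool} {V : FreeGroup α}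
    (hL : IsReduced (L ++ [x]))
    (h : (conjWord V (L ++ [x])).norm ≤ (conjWord V L).norm) :
    (conjWord V L).norm ≤ V.norm := by
  induction L using List.reverseRecOn generalizing x with
  | nil => simp [conjWord_nil]
  | append_singleton M y ih =>
    by_cases hlt : (conjWord V M).norm < (conjWord V (M ++ [y])).norm
    · have hyx : IsReduced [y, x] := hL.infix ⟨M, [], by simp⟩
      rw [conjWord_append] at hlt
      have h1 := norm_conjWord_singleton_of_gt hlt hyx
      rw [← conjWord_append, ← conjWord_append] at h1
      have h2 : M ++ [y] ++ [x] = M ++ [y, x] := by simp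
      rw [h2] at h
      omega
    · exact (not_lt.1 hlt).trans (ih (hL.infix ⟨[], [x], by simp⟩) (not_lt.1 hlt))

/-- If a conjugation along a reduced word starts by shortening but does not shorten in total,
then its last letter lengthens. -/
theorem norm_conjWord_lt_concat {M : List (α × Bool)} {x z : α × Bool} {V : FreeGroup α}
    (hL : IsReduced (M ++ [x])) (hhead : (M ++ [x]).head? = some z)
    (hz : (conjWord V [z]).norm < V.norm)
    (hle : V.norm ≤ (conjWord V (M ++ [x])).norm) :
    (conjWord V M).norm < (conjWord V (M ++ [x])).norm := by
  by_contra! hcon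
  cases M with
  | nil =>
    simp only [List.nil_append, List.head?_cons, Option.some.injEq] at hhead hle
    subst hhead
    omega
  | cons y M =>
    simp only [List.cons_append, List.head?_cons, Option.some.injEq] at hhead
    subst hhead
    rw [List.cons_append, conjWord_cons, conjWord_cons V y M] at hcon
    rw [List.cons_append, conjWord_cons] at hle
    have := norm_conjWord_le_of_concat_le (hL.infix ⟨[y], [], by simp⟩) hcon
    omega

theorem norm_le_norm_conjWord_cons {a : α × Bool} {L : List (α × Bool)} {V : FreeGroup α}
    (h : V.norm ≤ (conjWord V [a]).norm) (hL : IsReduced (a :: L)) :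
    V.norm ≤ (conjWord V (a :: L)).norm := by
  induction L generalizing a V with
  | nil => exact h
  | cons b L ih =>
    rw [conjWord_cons]
    refine h.trans (ih ?_ (isReduced_cons_cons.1 hL).2)
    by_contra! hlt
    have h1 := norm_conjWord_singleton_of_lt (b := (a.1, !a.2)) hlt (by
      rintro rfl
      simp [isReduced_cons_cons] at hL)
    rw [conjWord_singleton_inv] at h1
    omega

/-- An element that no letter shortens by conjugation is of minimal length in its conjugacy
class. -/
theorem norm_le_norm_conj_of_forall_letter {V : FreeGroup α}
    (h : ∀ a, V.norm ≤ (conjWord V [a]).norm) (g : FreeGroup α) :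
    V.norm ≤ (g⁻¹ * V * g).norm := by
  have hg : g⁻¹ * V * g = conjWord V g.toWord := by rw [conjWord, mk_toWord]
  have hred : IsReduced g.toWord := isReduced_toWord
  rw [hg]
  generalize g.toWord = L at hred
  cases L with
  | nil => rw [conjWord_nil]
  | cons a L => exact norm_le_norm_conjWord_cons (h a) hred

/-- Conjugating a cyclically reduced element along a reduced word first permutes it cyclically
and then lengthens it with every letter. -/
theorem exists_append_norm_conjWord {V : FreeGroup α} {P : List (α × Bool)} (hP : IsReduced P)
    (hV : ∀ g : FreeGroup α, V.norm ≤ (g⁻¹ * V * g).norm) :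
    ∃ P₁ P₂, P = P₁ ++ P₂ ∧
      (∀ g : FreeGroup α, (conjWord V P₁).norm ≤ (g⁻¹ * conjWord V P₁ * g).norm) ∧
      (conjWord V P).norm = 2 * P₂.length + (conjWord V P₁).norm := by
  induction P generalizing V with
  | nil => exact ⟨[], [], rfl, by simpa [conjWord_nil] using hV, by simp⟩
  | cons x P ih =>
    by_cases hx : V.norm < (conjWord V [x]).norm
    · refine ⟨[], x :: P, rfl, by simpa [conjWord_nil] using hV, ?_⟩
      rw [norm_conjWord_cons_of_gt hx hP, conjWord_nil, List.length_cons]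
      have h1 := norm_conjWord_singleton_eq_add_two hx
      omega
    · obtain ⟨P₁, P₂, rfl, hmin, hn⟩ := ih (V := conjWord V [x]) (hP.infix ⟨[x], [], by simp⟩)
        (fun g => by
          have := hV (mk [x] * g)
          have h2 : (mk [x] * g)⁻¹ * V * (mk [x] * g) = g⁻¹ * conjWord V [x] * g := by
            rw [conjWord]
            group
          rw [h2] at this
          omega)
      simp only [← conjWord_cons] at hmin hn
      exact ⟨x :: P₁, P₂, rfl, hmin, hn⟩

/-- Let `Δ = b c b⁻¹` with all words `b cⁿ b⁻¹` reduced. If conjugation by `Δ` does not shorten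
`V` and `b⁻¹ V b` is not cyclically reduced, then no positive power of `Δ` shortens `V`. -/
theorem norm_le_norm_conj_pow {B C : List (α × Bool)} (hC : C ≠ [])
    (hred : ∀ n ≠ 0, IsReduced (B ++ (List.replicate n C).flatten ++ invRev B))
    {Δ V : FreeGroup α} (hΔ : Δ = mk (B ++ C ++ invRev B))
    (h : V.norm ≤ (Δ⁻¹ * V * Δ).norm) {z : α × Bool}
    (hz : (conjWord (conjWord V B) [z]).norm < (conjWord V B).norm) (n : ℕ) :
    V.norm ≤ ((Δ ^ n)⁻¹ * V * Δ ^ n).norm := by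
  rcases Nat.eq_zero_or_pos n with rfl | hn
  · simp
  have hpow : Δ ^ n = mk (B ++ ((List.replicate n C).flatten ++ invRev B)) := by
    have h1 : Δ = mk B * mk C * (mk B)⁻¹ := by rw [hΔ, inv_mk, mul_mk, mul_mk]
    rw [h1, conj_pow, pow_mk, inv_mk, mul_mk, mul_mk, List.append_assoc]
  have hconj : (Δ ^ n)⁻¹ * V * Δ ^ n =
      conjWord (conjWord V B) ((List.replicate n C).flatten ++ invRev B) := by
    rw [hpow, ← conjWord_append, conjWord]
  have hconj₁ : Δ⁻¹ * V * Δ = conjWord (conjWord (conjWord V B) C) (invRev B) := by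
    rw [hΔ, ← conjWord_append, ← conjWord_append, ← List.append_assoc, conjWord]
  have hV : V = conjWord (conjWord V B) (invRev B) := by
    simp only [conjWord, ← inv_mk]
    group
  rw [hconj₁] at h
  rw [hconj]
  generalize conjWord V B = V' at *
  have hB : (invRev B).length = B.length := invRev_length
  have hredn := hred n hn.ne'
  rw [List.append_assoc] at hredn
  have hle := norm_conjWord_le V' (invRev B)
  rw [← hV] at hle
  obtain ⟨m, rfl⟩ := Nat.exists_eq_add_one_of_ne_zero hn.ne'
  have hsub : IsReduced ((List.replicate (m + 1) C).flatten ++ invRev B) :=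
    hredn.infix ⟨B, [], by simp⟩
  obtain ⟨M, x, rfl⟩ := (List.eq_nil_or_concat' C).resolve_left hC
  by_cases hhead : (M ++ [x]).head? = some z
  · have hred₁ : IsReduced (B ++ (M ++ [x]) ++ invRev B) := by simpa using hred 1 one_ne_zero
    have hBhead : (invRev B).head? ≠ some z := by
      intro hb
      obtain ⟨T, hT⟩ : ∃ T, invRev B = z :: T := List.head?_eq_some_iff.1 hb
      obtain ⟨T', hT'⟩ : ∃ T, M ++ [x] = z :: T := List.head?_eq_some_iff.1 hhead
      have hBT : B = invRev T ++ [(z.1, !z.2)] := by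
        rw [← invRev_invRev (L₁ := B), hT]
        simp [invRev]
      have : IsReduced [(z.1, !z.2), z] := hred₁.infix ⟨invRev T, T' ++ invRev B, by
        rw [hT', hBT]; simp⟩
      simp [isReduced_cons_cons] at this
    have hVn := norm_conjWord_of_lt hz (hred₁.infix ⟨_, [], List.append_nil _⟩) hBhead
    rw [← hV] at hVn
    have hle₁ := norm_conjWord_le (conjWord V' (M ++ [x])) (invRev B)
    have hlast := norm_conjWord_lt_concat (V := V')
      (hred₁.infix ⟨B, invRev B, rfl⟩) hhead hz (by omega)
    have hsplit : (List.replicate (m + 1) (M ++ [x])).flatten ++ invRev B =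
        M ++ (x :: ((List.replicate m (M ++ [x])).flatten ++ invRev B)) := by
      simp [List.replicate_succ]
    rw [hsplit] at hsub ⊢
    rw [conjWord_append] at hlast hle₁ h ⊢
    rw [norm_conjWord_cons_of_gt hlast (hsub.infix ⟨M, [], by simp⟩), List.length_append]
    omega
  · rw [norm_conjWord_of_lt hz hsub, List.length_append]
    · omega
    · simp only [List.replicate_succ, List.flatten_cons, List.append_assoc]
      rw [← List.append_assoc M, List.head?_append_of_ne_nil _ (by simp)]
      exact hhead

end FreeGroup

/-- **Lemma 4.** Suppose `Δ` is not cyclically reduced and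
`‖V‖ ≤ ‖Δ⁻¹ V Δ‖`, `‖V‖ ≤ ‖Δ V Δ⁻¹‖`. Then either `V` is `Δ`-reduced, or
`Δ` and `V` admit the special decomposition of Lemma 4(2): namely
`Δ = U₁⁻¹ U₂⁻¹ Δ₁₁⁻¹ Δ₂ Δ₁₁ U₂ U₁` and `V = U₁⁻¹ U₂⁻¹ W U₂ U₁` (both norm-additively)
with `W` cyclically reduced, and there is an integer `k` with `|k| > 1` such that
`‖Δ^(-k) V Δ^k‖ < ‖V‖` and `Δ^(-k) V Δ^k` is `Δ`-reduced. -/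
theorem delta_reduction_of_not_cyclically_reduced
    {α : Type*} [DecidableEq α] (Δ V : FreeGroup α)
    (hΔ : ∃ g : FreeGroup α, (g⁻¹ * Δ * g).norm < Δ.norm)
    (h1 : V.norm ≤ (Δ⁻¹ * V * Δ).norm)
    (h2 : V.norm ≤ (Δ * V * Δ⁻¹).norm) :
    (∀ k : ℤ, V.norm ≤ (Δ ^ (-k) * V * Δ ^ k).norm) ∨
    (∃ (U₁ U₂ Δ₁₁ Δ₂ W : FreeGroup α) (k : ℤ), 1 < |k| ∧
      Δ = U₁⁻¹ * U₂⁻¹ * Δ₁₁⁻¹ * Δ₂ * Δ₁₁ * U₂ * U₁ ∧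
      Δ.norm = 2 * U₁.norm + 2 * U₂.norm + 2 * Δ₁₁.norm + Δ₂.norm ∧
      V = U₁⁻¹ * U₂⁻¹ * W * U₂ * U₁ ∧
      V.norm = 2 * U₁.norm + 2 * U₂.norm + W.norm ∧
      (∀ g : FreeGroup α, W.norm ≤ (g⁻¹ * W * g).norm) ∧
      (Δ ^ (-k) * V * Δ ^ k).norm < V.norm ∧
      (∀ j : ℤ,
        (Δ ^ (-k) * V * Δ ^ k).norm ≤ (Δ ^ (-j) * (Δ ^ (-k) * V * Δ ^ k) * Δ ^ j).norm)) := by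
  obtain ⟨B, C, hword, hpow⟩ : ∃ B C, Δ.toWord = B ++ C ++ invRev B ∧
      ∀ n ≠ 0, IsReduced (B ++ (List.replicate n C).flatten ++ invRev B) :=
    ⟨reduceCyclically.conjugator Δ.toWord, reduceCyclically Δ.toWord,
      (reduceCyclically.conj_conjugator_reduceCyclically _).symm, fun n hn =>
        IsReduced.append_flatten_replicate_append
          (reduceCyclically.isCyclicallyReduced isReduced_toWord)
          (by
            rw [reduceCyclically.conj_conjugator_reduceCyclically]
            exact isReduced_toWord) hn⟩
  have hmk : Δ = mk (B ++ C ++ invRev B) := by rw [← hword, mk_toWord]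
  have hred : IsReduced (B ++ C ++ invRev B) := by
    rw [← hword]
    exact isReduced_toWord
  have hC : C ≠ [] := by
    rintro rfl
    have : Δ = 1 := by
      rw [hmk, List.append_nil, ← mul_mk, ← inv_mk, mul_inv_cancel]
    simp [this] at hΔ
  by_cases hloc : ∃ z, (conjWord (conjWord V B) [z]).norm < (conjWord V B).norm
  · obtain ⟨z, hz⟩ := hloc
    left
    have hinvRev : ∀ n, invRev (B ++ (List.replicate n C).flatten ++ invRev B) =
        B ++ (List.replicate n (invRev C)).flatten ++ invRev B := by
      intro n
      have hflat : invRev (List.replicate n C).flatten = (List.replicate n (invRev C)).flatten := by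
        induction n with
        | zero => simp
        | succ n ih =>
          rw [List.replicate_succ', List.flatten_concat, invRev_append, ih, List.replicate_succ,
            List.flatten_cons]
      rw [invRev_append, invRev_append, invRev_invRev, hflat, List.append_assoc]
    have hpos := norm_le_norm_conj_pow hC hpow hmk h1 hz
    have hneg := norm_le_norm_conj_pow (C := invRev C) (Δ := Δ⁻¹)
      (fun h => hC (by rw [← invRev_invRev (L₁ := C), h]; rfl))
      (fun n hn => by
        rw [← hinvRev, isReduced_iff_reduce_eq, reduce_invRev, (hpow n hn).reduce_eq])
      (by simp [hmk, inv_mk])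
      (by simpa using h2) hz
    intro k
    obtain ⟨n, rfl | rfl⟩ := k.eq_nat_or_neg
    · simpa using hpos n
    · simpa using hneg n
  push Not at hloc
  by_cases hV : ∀ k : ℤ, V.norm ≤ (Δ ^ (-k) * V * Δ ^ k).norm
  · exact Or.inl hV
  right
  push Not at hV
  obtain ⟨P₁, P₂, hP, hmin, hnorm⟩ := exists_append_norm_conjWord
    (hred.infix ⟨B ++ C, [], by simp⟩ : IsReduced (invRev B))
    (norm_le_norm_conj_of_forall_letter hloc)
  have hBV : conjWord (conjWord V B) (invRev B) = V := by
    simp only [conjWord, ← inv_mk]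
    group
  have hP₁ : IsReduced P₁ := hred.infix ⟨B ++ C, P₂, by simp [hP]⟩
  have hP₂ : IsReduced P₂ := hred.infix ⟨B ++ C ++ P₁, [], by simp [hP]⟩
  have hB : mk B = (mk P₂)⁻¹ * (mk P₁)⁻¹ := by
    rw [← mul_inv_rev, mul_mk, ← hP, ← inv_mk, inv_inv]
  have hlen : B.length = P₁.length + P₂.length := by
    rw [← List.length_append, ← hP, invRev_length]
  let f : ℤ → ℕ := fun k => (Δ ^ (-k) * V * Δ ^ k).norm
  obtain ⟨k, hk⟩ : ∃ k, ∀ j, f k ≤ f j :=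
    ⟨Function.argmin f, fun j => Function.argmin_le f j⟩
  obtain ⟨j, hj⟩ := hV
  have hlt : f k < V.norm := (hk j).trans_lt hj
  refine ⟨1, mk P₂, mk P₁, mk C, conjWord (conjWord V B) P₁, k, ?_, ?_, ?_, ?_, ?_, hmin, hlt, ?_⟩
  · by_contra! hk1
    obtain ⟨hl, hu⟩ := abs_le.1 hk1
    interval_cases k
    · simp [f] at hlt; omega
    · simp [f] at hlt
    · simp [f] at hlt; omega
  · conv_lhs => rw [hmk, ← mul_mk, ← mul_mk, ← inv_mk, hB]
    group
  · have hCred : IsReduced C := hred.infix ⟨B, invRev B, rfl⟩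
    rw [hP₁.norm_mk, hP₂.norm_mk, hCred.norm_mk, FreeGroup.norm, hword]
    simp [hlen]
    ring
  · conv_lhs => rw [← hBV, hP, conjWord_append, conjWord]
    group
  · rw [hBV] at hnorm
    rw [hnorm, hP₂.norm_mk, FreeGroup.norm_one]
    ring
  · intro i
    have hi : Δ ^ (-i) * (Δ ^ (-k) * V * Δ ^ k) * Δ ^ i = Δ ^ (-(k + i)) * V * Δ ^ (k + i) := by
      group
    rw [hi]
    exact hk (k + i)
end

section
/- Let U₁, U₂, Δ₁₁, Δ₂, W₀ ∈ F with U₂ ≠ 1 and Δ₁₁ ≠ 1, and let k be an integer with k > 1. Set W := Δ₁₁⁻¹ * Δ₂^k * Δ₁₁ * U₂ * W₀, Δ := U₁⁻¹ * U₂⁻¹ * Δ₁₁⁻¹ * Δ₂ * Δ₁₁ * U₂ * U₁, and V := U₁⁻¹ * U₂⁻¹ * W * U₂ * U₁. Assume: ‖Δ‖ = 2‖U₁‖ + 2‖U₂‖ + 2‖Δ₁₁‖ + ‖Δ₂‖; ‖W‖ = 2‖Δ₁₁‖ + k‖Δ₂‖ + ‖U₂‖ + ‖W₀‖; ‖V‖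 = ‖W‖ + 2‖U₂‖ + 2‖U₁‖; and W is cyclically reduced. Then ‖Δ⁻¹ * V * Δ‖ = ‖V‖ + 2‖Δ₁₁‖ > ‖V‖, ‖Δ * V * Δ⁻¹‖ > ‖V‖, and Δ^(−k) * V * Δ^k = U₁⁻¹ * W₀ * Δ₁₁⁻¹ * Δ₂^k * Δ₁₁ * U₂ * U₁ with ‖Δ^(−k) * V * Δ^k‖ ≤ ‖W‖ + 2‖U₁‖ < ‖V‖. -/
open FreeGroup

namespace FreeGroup

variable {α : Type*}

theorem IsCyclicallyReduced.append_self {L : List (α × Bool)} (h : IsCyclicallyReduced L) :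
    IsReduced (L ++ L) := by
  simpa [List.replicate] using (h.flatten_replicate 2).isReduced

variable [DecidableEq α]

theorem isReduced_of_length_le_norm_mk {L : List (α × Bool)} (h : L.length ≤ (mk L).norm) :
    IsReduced L :=
  .of_reduce_eq <| (reduce.red.sublist).eq_of_length_le (by simpa [norm] using h)

theorem norm_pow_le (x : FreeGroup α) (n : ℕ) : (x ^ n).norm ≤ n * x.norm := by
  induction n with
  | zero => simp
  | succ n ih =>
    rw [pow_succ, add_one_mul]
    exact (norm_mul_le _ _).trans (by omega)

theorem IsReduced.invRev {L : List (α × Bool)} (h : IsReduced L) :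
    IsReduced (FreeGroup.invRev L) :=
  .of_reduce_eq <| by rw [reduce_invRev, h.reduce_eq]

/-- A reduced word of minimal length in its conjugacy class is cyclically reduced. -/
theorem IsReduced.isCyclicallyReduced_of_norm_le {L : List (α × Bool)} (h : IsReduced L)
    (hmin : ∀ g : FreeGroup α, (mk L).norm ≤ (g⁻¹ * mk L * g).norm) :
    IsCyclicallyReduced L := by
  have hL := reduceCyclically.conj_conjugator_reduceCyclically L
  have hcyc := reduceCyclically.isCyclicallyReduced h
  set c := reduceCyclically.conjugator L
  set r := reduceCyclically L
  have hconj : (mk c)⁻¹ * mk L * mk c = mk r := by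
    rw [← hL, ← mul_mk, ← mul_mk, ← inv_mk]
    group
  have hle := hmin (mk c)
  rw [hconj, h.norm_mk, hcyc.isReduced.norm_mk, ← hL] at hle
  simp only [List.length_append, invRev_length] at hle
  have hc : c = [] := List.eq_nil_of_length_eq_zero (by omega)
  rw [hc] at hL
  simp only [List.nil_append, invRev_empty, List.append_nil] at hL
  exact hL ▸ hcyc

end FreeGroup

/-- **Case 2(iii) of Lemma 4.** With
`W = Δ₁₁⁻¹ Δ₂^k Δ₁₁ U₂ W₀` cyclically reduced,
`Δ = U₁⁻¹ U₂⁻¹ Δ₁₁⁻¹ Δ₂ Δ₁₁ U₂ U₁` and `V = U₁⁻¹ U₂⁻¹ W U₂ U₁`, all norm-additive,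
one has `‖Δ⁻¹ V Δ‖ = ‖V‖ + 2‖Δ₁₁‖ > ‖V‖`, `‖Δ V Δ⁻¹‖ > ‖V‖`, and
`Δ^(-k) V Δ^k = U₁⁻¹ W₀ Δ₁₁⁻¹ Δ₂^k Δ₁₁ U₂ U₁` with
`‖Δ^(-k) V Δ^k‖ ≤ ‖W‖ + 2‖U₁‖ < ‖V‖`. -/
theorem case_two_three_of_lemma_four
    {α : Type*} [DecidableEq α] (U₁ U₂ Δ₁₁ Δ₂ W₀ : FreeGroup α)
    (hU₂ : U₂ ≠ 1) (hΔ₁₁ : Δ₁₁ ≠ 1) (k : ℤ) (hk : 1 < k)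
    (W Δ V : FreeGroup α)
    (hWdef : W = Δ₁₁⁻¹ * Δ₂ ^ k * Δ₁₁ * U₂ * W₀)
    (hΔdef : Δ = U₁⁻¹ * U₂⁻¹ * Δ₁₁⁻¹ * Δ₂ * Δ₁₁ * U₂ * U₁)
    (hVdef : V = U₁⁻¹ * U₂⁻¹ * W * U₂ * U₁)
    (hΔnorm : Δ.norm = 2 * U₁.norm + 2 * U₂.norm + 2 * Δ₁₁.norm + Δ₂.norm)
    (hWnorm : (W.norm : ℤ) = 2 * Δ₁₁.norm + k * Δ₂.norm + U₂.norm + W₀.norm)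
    (hVnorm : V.norm = W.norm + 2 * U₂.norm + 2 * U₁.norm)
    (hWcyc : ∀ g : FreeGroup α, W.norm ≤ (g⁻¹ * W * g).norm) :
    (Δ⁻¹ * V * Δ).norm = V.norm + 2 * Δ₁₁.norm ∧
    V.norm < (Δ⁻¹ * V * Δ).norm ∧
    V.norm < (Δ * V * Δ⁻¹).norm ∧
    Δ ^ (-k) * V * Δ ^ k = U₁⁻¹ * W₀ * Δ₁₁⁻¹ * Δ₂ ^ k * Δ₁₁ * U₂ * U₁ ∧
    (Δ ^ (-k) * V * Δ ^ k).norm ≤ W.norm + 2 * U₁.norm ∧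
    W.norm + 2 * U₁.norm < V.norm := by
  obtain ⟨m, rfl⟩ : ∃ m : ℕ, k = m + 2 := ⟨(k - 2).toNat, by omega⟩
  have hwords (x : FreeGroup α) : ∃ L, x = mk L ∧ x.norm = L.length :=
    ⟨x.toWord, mk_toWord.symm, rfl⟩
  have hu : 0 < U₂.norm := Nat.pos_of_ne_zero (norm_eq_zero.not.mpr hU₂)
  have ha : 0 < Δ₁₁.norm := Nat.pos_of_ne_zero (norm_eq_zero.not.mpr hΔ₁₁)
  have hd : Δ₂ ≠ 1 := by
    rintro rfl
    rw [hΔdef] at hΔnorm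
    simp [mul_assoc] at hΔnorm
    omega
  have hconj₁ : Δ⁻¹ * V * Δ =
      U₁⁻¹ * U₂⁻¹ * Δ₁₁⁻¹ * Δ₂ * Δ₂ ^ m * Δ₁₁ * U₂ * W₀ * Δ₁₁⁻¹ * Δ₂ * Δ₁₁ * U₂ * U₁ := by
    rw [hVdef, hΔdef, hWdef]
    group
  have hconj₂ : Δ * V * Δ⁻¹ =
      U₁⁻¹ * U₂⁻¹ * Δ₁₁⁻¹ * Δ₂ * Δ₂ * Δ₂ * Δ₂ ^ m * Δ₁₁ * U₂ * W₀ * Δ₁₁⁻¹ * Δ₂⁻¹ *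
        Δ₁₁ * U₂ * U₁ := by
    rw [hVdef, hΔdef, hWdef]
    group
  have hconj₃ : Δ ^ (-((m : ℤ) + 2)) * V * Δ ^ ((m : ℤ) + 2) =
      U₁⁻¹ * W₀ * Δ₁₁⁻¹ * Δ₂ ^ ((m : ℤ) + 2) * Δ₁₁ * U₂ * U₁ := by
    have hpow (n : ℤ) : Δ ^ n = U₁⁻¹ * U₂⁻¹ * Δ₁₁⁻¹ * Δ₂ ^ n * Δ₁₁ * U₂ * U₁ := by
      have := conj_zpow (i := n) (a := (Δ₁₁ * U₂ * U₁)⁻¹) (b := Δ₂)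
      rw [hΔdef]
      simpa [mul_assoc] using this
    rw [hpow, hpow, hVdef, hWdef]
    group
  have hWdef' : W = Δ₁₁⁻¹ * Δ₂ * Δ₂ * Δ₂ ^ m * Δ₁₁ * U₂ * W₀ := by
    rw [hWdef]
    group
  have hpownorm : (Δ₂ ^ ((m : ℤ) + 2)).norm ≤ (m + 2) * Δ₂.norm := by
    exact_mod_cast norm_pow_le Δ₂ (m + 2)
  obtain ⟨P, rfl, hP⟩ := hwords U₁
  obtain ⟨Q, rfl, hQ⟩ := hwords U₂
  obtain ⟨A, rfl, hA⟩ := hwords Δ₁₁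
  obtain ⟨D, rfl, hD⟩ := hwords Δ₂
  obtain ⟨Z, rfl, hZ⟩ := hwords W₀
  have hD0 : D ≠ [] := by rintro rfl; exact hd rfl
  have hA0 : invRev A ≠ [] := by
    intro h
    rw [← invRev_length, h, List.length_nil] at hA
    omega
  obtain ⟨E, hE, hElen⟩ : ∃ E, mk D ^ m = mk E ∧ E.length = m * D.length :=
    ⟨(List.replicate m D).flatten, pow_mk m, by simp⟩
  rw [hE] at hconj₁ hconj₂ hWdef'
  simp only [inv_mk, mul_mk] at hconj₁ hconj₂ hWdef' hΔdef
  have hWnat : W.norm = 2 * A.length + (m + 2) * D.length + Q.length + Z.length := by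
    zify
    rw [hWnorm, hA, hD, hQ, hZ]
  have hΔred : IsReduced (invRev P ++ invRev Q ++ invRev A ++ D ++ A ++ Q ++ P) := by
    apply isReduced_of_length_le_norm_mk
    rw [← hΔdef, hΔnorm]
    simp only [List.length_append, invRev_length]
    omega
  have hWred : IsReduced (invRev A ++ D ++ D ++ E ++ A ++ Q ++ Z) := by
    apply isReduced_of_length_le_norm_mk
    rw [← hWdef', hWnat]
    simp only [List.length_append, invRev_length, hElen]
    linarith
  have hWWred := (hWred.isCyclicallyReduced_of_norm_le (hWdef' ▸ hWcyc)).append_self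
  have hleft : IsReduced (invRev P ++ invRev Q ++ invRev A ++ D) :=
    hΔred.infix ⟨[], A ++ Q ++ P, by simp⟩
  have hred₁ : IsReduced (invRev P ++ invRev Q ++ invRev A ++ D ++
      (E ++ A ++ Q ++ Z ++ invRev A) ++ D ++ (A ++ Q ++ P)) := by
    refine IsReduced.append_overlap ?_ (hΔred.infix ⟨invRev P ++ invRev Q ++ invRev A, [], by simp⟩) hD0
    rw [List.append_assoc]
    refine IsReduced.append_overlap hleft ?_ hD0
    exact hWWred.infix ⟨invRev A ++ D, D ++ E ++ A ++ Q ++ Z, by simp⟩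
  have hright : IsReduced (invRev A ++ (invRev D ++ A ++ Q ++ P)) :=
    hΔred.invRev.infix ⟨invRev P ++ invRev Q, [], by simp⟩
  have hDD : IsReduced (D ++ (D ++ E ++ A ++ Q ++ Z ++ invRev A)) :=
    hWWred.infix ⟨invRev A, D ++ D ++ E ++ A ++ Q ++ Z, by simp⟩
  have hred₂ : IsReduced (invRev P ++ invRev Q ++ invRev A ++ D ++
      (D ++ D ++ E ++ A ++ Q ++ Z) ++ invRev A ++ (invRev D ++ A ++ Q ++ P)) := by
    refine IsReduced.append_overlap ?_ hright hA0
    rw [List.append_assoc]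
    refine IsReduced.append_overlap hleft ?_ hD0
    have h := IsReduced.append_overlap (L₁ := D) (L₂ := D)
      (hDD.infix ⟨[], E ++ A ++ Q ++ Z ++ invRev A, by simp⟩) (by simpa using hDD) hD0
    simpa using h
  have hn₁ := hred₁.norm_mk
  have hn₂ := hred₂.norm_mk
  simp only [List.length_append, invRev_length, hElen] at hn₁ hn₂
  simp only [List.append_assoc] at hn₁ hn₂ hconj₁ hconj₂
  rw [← hconj₁] at hn₁
  rw [← hconj₂] at hn₂
  have hmul : (m + 2) * D.length = m * D.length + 2 * D.length := by ring
  refine ⟨by omega, by omega, by omega, hconj₃, ?_, by omega⟩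
  rw [hconj₃]
  have h₁ := norm_mul_le ((mk P)⁻¹ * mk Z * (mk A)⁻¹ * mk D ^ ((m : ℤ) + 2) * mk A * mk Q) (mk P)
  have h₂ := norm_mul_le ((mk P)⁻¹ * mk Z * (mk A)⁻¹ * mk D ^ ((m : ℤ) + 2) * mk A) (mk Q)
  have h₃ := norm_mul_le ((mk P)⁻¹ * mk Z * (mk A)⁻¹ * mk D ^ ((m : ℤ) + 2)) (mk A)
  have h₄ := norm_mul_le ((mk P)⁻¹ * mk Z * (mk A)⁻¹) (mk D ^ ((m : ℤ) + 2))
  have h₅ := norm_mul_le ((mk P)⁻¹ * mk Z) (mk A)⁻¹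
  have h₆ := norm_mul_le (mk P)⁻¹ (mk Z)
  rw [norm_inv_eq] at h₅ h₆
  rw [hD] at hpownorm
  omega
end
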